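/- Let U and V be distinct open strata of (C, Φ), set k := d(U,V) − 1, and fix u ∈ U. For every y ∈ closure(V) and every φ ∈ Φ(U,V), one has φ(u) ≠ φ(y) and t_φ(y) := φ(u)/(φ(u) − φ(y)) lies in the half-open interval (0,1]. Set t(y) := max_{φ ∈ Φ(U,V)} t_φ(y) and p(y) := (1 − t(y))·u + t(y)·y. Then: (a) the function t : closure(V) → (0,1] is continuous; (b) for every y ∈ closure(V), the segment [p(y), y] is contained in closure(V); (c) for every y ∈ closure(V), p(y) ∈ closure(V) ∩ U_{≤k}; (d) p(y) = y if and only if y ∈ closure(V) ∩ U_{≤k}. In particular, p is a continuous retraction of closure(V) onto closure(V) ∩ U_{≤k}. -/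

import Mathlib

open Set

noncomputable section

abbrev Rn (n : ℕ) : Type := Fin n → ℝ

abbrev AffForm (n : ℕ) : Type := (Rn n) →ᵃ[ℝ] ℝ

/-- A polyhedron: a nonempty intersection of finitely many closed half-spaces. -/
def IsPolyhedron {n : ℕ} (C : Set (Rn n)) : Prop :=
  C.Nonempty ∧ ∃ Ψ : Finset (AffForm n), (∀ ψ ∈ Ψ, ψ.linear ≠ 0) ∧
    C = {x | ∀ ψ ∈ Ψ, 0 ≤ ψ x}

/-- The stratum of `(C, Φ)` attached to a sign function `ε`. -/
def stratum {n : ℕ} (C : Set (Rn n)) (Φ : Finset (AffForm n)) (ε : AffForm n → ℝ) :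
    Set (Rn n) :=
  {x | x ∈ C ∧ ∀ φ ∈ Φ, 0 < ε φ * φ x}

/-- Open strata of `(C, Φ)`: nonempty sets of the form `stratum C Φ ε` for a sign function. -/
def IsOpenStratum {n : ℕ} (C : Set (Rn n)) (Φ : Finset (AffForm n)) (U : Set (Rn n)) : Prop :=
  U.Nonempty ∧ ∃ ε : AffForm n → ℝ, (∀ φ, ε φ = 1 ∨ ε φ = -1) ∧ U = stratum C Φ ε

/-- `φ` separates `U` and `V` if it is strictly positive on one and strictly negative
on the other. -/
def Separates {n : ℕ} (φ : AffForm n) (U V : Set (Rn n)) : Prop :=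
  ((∀ x ∈ U, 0 < φ x) ∧ (∀ x ∈ V, φ x < 0)) ∨
  ((∀ x ∈ U, φ x < 0) ∧ (∀ x ∈ V, 0 < φ x))

/-- `Φ(U,V)`: the set of forms in `Φ` separating `U` and `V`. -/
def sepSet {n : ℕ} (Φ : Finset (AffForm n)) (U V : Set (Rn n)) : Set (AffForm n) :=
  {φ | φ ∈ Φ ∧ Separates φ U V}

/-- `d(U,V)`: the number of forms in `Φ` separating `U` and `V`. -/
def sdist {n : ℕ} (Φ : Finset (AffForm n)) (U V : Set (Rn n)) : ℕ :=
  (sepSet Φ U V).ncard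

/-- `U_{≤ k}`: the union of the closures of the open strata `W` with `d(U,W) ≤ k`. -/
def below {n : ℕ} (C : Set (Rn n)) (Φ : Finset (AffForm n)) (U : Set (Rn n)) (k : ℕ) :
    Set (Rn n) :=
  ⋃ W ∈ {W | IsOpenStratum C Φ W ∧ sdist Φ U W ≤ k}, closure W


lemma aff_combo {n : ℕ} (φ : AffForm n) (u y : Rn n) (s : ℝ) :
    φ ((1 - s) • u + s • y) = (1 - s) * φ u + s * φ y := by
  have := Convex.combo_affine_apply (f := φ) (x := u) (y := y) (a := 1 - s) (b := s) (by ring)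
  simpa using this

lemma aff_cont {n : ℕ} (φ : AffForm n) : Continuous φ := φ.continuous_of_finiteDimensional

lemma poly_closed {n : ℕ} {C : Set (Rn n)} (hC : IsPolyhedron C) : IsClosed C := by
  obtain ⟨_, Ψ, _, rfl⟩ := hC
  simp only [Set.setOf_forall]
  exact isClosed_biInter fun ψ _ => isClosed_le continuous_const (aff_cont ψ)

lemma poly_combo {n : ℕ} {C : Set (Rn n)} (hC : IsPolyhedron C) {u y : Rn n} (hu : u ∈ C)
    (hy : y ∈ C) {s : ℝ} (h0 : 0 ≤ s) (h1 : s ≤ 1) : (1 - s) • u + s • y ∈ C := by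
  obtain ⟨_, Ψ, _, rfl⟩ := hC
  intro ψ hψ
  rw [aff_combo]
  have h2 : 0 ≤ 1 - s := by linarith
  exact add_nonneg (mul_nonneg h2 (hu ψ hψ)) (mul_nonneg h0 (hy ψ hψ))

lemma stratum_mem {n : ℕ} {C : Set (Rn n)} {Φ : Finset (AffForm n)} {V : Set (Rn n)}
    (hV : IsOpenStratum C Φ V) {v : Rn n} (hv : v ∈ V) :
    v ∈ C ∧ (∀ φ ∈ Φ, φ v ≠ 0) ∧ V = {x | x ∈ C ∧ ∀ φ ∈ Φ, 0 < φ v * φ x} := by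
  obtain ⟨_, ε, hε, rfl⟩ := hV
  refine ⟨hv.1, fun φ hφ h => by simpa [h] using hv.2 φ hφ, ?_⟩
  ext x
  refine and_congr_right fun _ => forall₂_congr fun φ hφ => ?_
  have h := hv.2 φ hφ
  rcases hε φ with e | e <;> rw [e] at h ⊢
  · rw [one_mul] at h ⊢
    exact (mul_pos_iff_of_pos_left h).symm
  · constructor
    · intro h'; nlinarith
    · intro h'
      have : φ x < 0 := by
        by_contra! hc
        nlinarith
      linarith

lemma stratum_of {n : ℕ} {C : Set (Rn n)} {Φ : Finset (AffForm n)} {w : Rn n} (hw : w ∈ C)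
    (h : ∀ φ ∈ Φ, φ w ≠ 0) : ∃ W, IsOpenStratum C Φ W ∧ w ∈ W := by
  classical
  have key : w ∈ stratum C Φ (fun φ => if 0 < φ w then 1 else -1) := by
    refine ⟨hw, fun φ hφ => ?_⟩
    dsimp only
    split_ifs with h1
    · linarith
    · have := lt_of_le_of_ne (not_lt.1 h1) (h φ hφ)
      linarith
  refine ⟨_, ⟨⟨w, key⟩, _, fun φ => ?_, rfl⟩, key⟩
  split_ifs <;> simp

lemma sep_iff {n : ℕ} {C : Set (Rn n)} {Φ : Finset (AffForm n)} {U V : Set (Rn n)}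
    (hU : IsOpenStratum C Φ U) (hV : IsOpenStratum C Φ V) {u v : Rn n} (hu : u ∈ U) (hv : v ∈ V)
    (φ : AffForm n) : φ ∈ sepSet Φ U V ↔ φ ∈ Φ ∧ φ u * φ v < 0 := by
  refine and_congr_right fun hφ => ?_
  constructor
  · rintro (⟨a, b⟩ | ⟨a, b⟩)
    · exact mul_neg_of_pos_of_neg (a u hu) (b v hv)
    · exact mul_neg_of_neg_of_pos (a u hu) (b v hv)
  · intro h
    have eU : ∀ x ∈ U, 0 < φ u * φ x := fun x hx => by
      rw [(stratum_mem hU hu).2.2] at hx; exact hx.2 φ hφ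
    have eV : ∀ x ∈ V, 0 < φ v * φ x := fun x hx => by
      rw [(stratum_mem hV hv).2.2] at hx; exact hx.2 φ hφ
    rcases mul_neg_iff.1 h with ⟨a, b⟩ | ⟨a, b⟩
    · exact Or.inl ⟨fun x hx => pos_of_mul_pos_right (eU x hx) a.le |> fun h => h,
        fun x hx => by by_contra! hc; nlinarith [eV x hx]⟩
    · exact Or.inr ⟨fun x hx => by by_contra! hc; nlinarith [eU x hx],
        fun x hx => by by_contra! hc; nlinarith [eV x hx]⟩

lemma mem_closure_of_ray {n : ℕ} {W : Set (Rn n)} {p q : Rn n}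
    (h : ∀ᶠ s in nhdsWithin (0 : ℝ) (Set.Ioi 0), (1 - s) • p + s • q ∈ W) : p ∈ closure W := by
  have hc : Continuous fun s : ℝ => (1 - s) • p + s • q := by fun_prop
  have ht : Filter.Tendsto (fun s : ℝ => (1 - s) • p + s • q) (nhdsWithin (0 : ℝ) (Set.Ioi 0))
      (nhds p) := by
    have := (hc.tendsto 0).mono_left (nhdsWithin_le_nhds (s := Set.Ioi 0))
    simpa using this
  exact mem_closure_of_tendsto ht h

lemma closure_eq {n : ℕ} {C : Set (Rn n)} {Φ : Finset (AffForm n)} {V : Set (Rn n)}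
    (hC : IsPolyhedron C) (hV : IsOpenStratum C Φ V) {v : Rn n} (hv : v ∈ V) :
    closure V = {x | x ∈ C ∧ ∀ φ ∈ Φ, 0 ≤ φ v * φ x} := by
  obtain ⟨hvC, hv0, e⟩ := stratum_mem hV hv
  apply Set.Subset.antisymm
  · refine closure_minimal ?_ ?_
    · intro x hx
      rw [e] at hx
      exact ⟨hx.1, fun φ hφ => (hx.2 φ hφ).le⟩
    · have : {x | x ∈ C ∧ ∀ φ ∈ Φ, 0 ≤ φ v * φ x} =
          C ∩ ⋂ φ ∈ Φ, {x | 0 ≤ φ v * φ x} := by ext x; simp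
      rw [this]
      exact (poly_closed hC).inter (isClosed_biInter fun φ _ =>
        isClosed_le continuous_const (continuous_const.mul (aff_cont φ)))
  · rintro x ⟨hxC, hx⟩
    apply mem_closure_of_ray (q := v)
    filter_upwards [Ioo_mem_nhdsGT (zero_lt_one (α := ℝ))] with s hs
    rw [e]
    refine ⟨poly_combo hC hxC hvC hs.1.le hs.2.le, fun φ hφ => ?_⟩
    rw [aff_combo]
    have h1 := mul_nonneg (sub_nonneg.2 hs.2.le) (hx φ hφ)
    have h2 := mul_pos hs.1 (mul_self_pos.2 (hv0 φ hφ))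
    nlinarith

lemma sepSet_finite {n : ℕ} (Φ : Finset (AffForm n)) (U V : Set (Rn n)) :
    (sepSet Φ U V).Finite := Φ.finite_toSet.subset fun _ h => h.1

lemma mem_below {n : ℕ} {C : Set (Rn n)} {Φ : Finset (AffForm n)} {U V : Set (Rn n)}
    (hC : IsPolyhedron C) (hU : IsOpenStratum C Φ U) (hV : IsOpenStratum C Φ V)
    {u p : Rn n} (hu : u ∈ U) (hp : p ∈ closure V) {φ₀ : AffForm n} (h₀ : φ₀ ∈ sepSet Φ U V)
    (hz : φ₀ p = 0) : p ∈ below C Φ U (sdist Φ U V - 1) := by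
  obtain ⟨v, hv⟩ := hV.1
  obtain ⟨huC, hu0, eU⟩ := stratum_mem hU hu
  obtain ⟨hvC, hv0, eV⟩ := stratum_mem hV hv
  rw [closure_eq hC hV hv] at hp
  -- small parameters for which no form changes its sign
  have hev : ∀ᶠ s in nhdsWithin (0 : ℝ) (Set.Ioi 0), ∀ φ ∈ Φ, φ p ≠ 0 →
      0 < φ p * φ ((1 - s) • p + s • u) := by
    rw [Filter.eventually_all_finset]
    intro φ hφ
    by_cases h : φ p = 0
    · simp [h]
    have hc : Continuous fun s : ℝ => φ p * φ ((1 - s) • p + s • u) :=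
      continuous_const.mul ((aff_cont φ).comp (by fun_prop))
    have h1 : ∀ᶠ s in nhds (0 : ℝ), 0 < φ p * φ ((1 - s) • p + s • u) := by
      apply hc.continuousAt.eventually_const_lt
      simpa using h
    filter_upwards [nhdsWithin_le_nhds h1] with s hs _ using hs
  obtain ⟨r, hr0, hr⟩ := (mem_nhdsGT_iff_exists_Ioo_subset).1
    (Filter.inter_mem hev (Ioo_mem_nhdsGT (zero_lt_one (α := ℝ))))
  replace hr0 : 0 < r := hr0
  have sgn : ∀ s ∈ Set.Ioo 0 r, ∀ φ ∈ Φ, φ p = 0 → φ ((1 - s) • p + s • u) = s * φ u := by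
    intro s hs φ hφ h
    rw [aff_combo, h]; ring
  have inC : ∀ s ∈ Set.Ioo 0 r, (1 - s) • p + s • u ∈ C := fun s hs =>
    poly_combo hC hp.1 huC (hr hs).2.1.le (hr hs).2.2.le
  have hr2 : r / 2 ∈ Set.Ioo 0 r := ⟨by linarith, by linarith⟩
  obtain ⟨W, hW, hwW⟩ := stratum_of (Φ := Φ) (inC _ hr2) (by
    intro φ hφ
    by_cases h : φ p = 0
    · rw [sgn _ hr2 φ hφ h]
      exact mul_ne_zero hr2.1.ne' (hu0 φ hφ)
    · intro h'
      have := (hr hr2).1 φ hφ h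
      rw [h'] at this
      simp at this)
  obtain ⟨-, hw0, eW⟩ := stratum_mem hW hwW
  refine Set.mem_biUnion (x := W) ⟨hW, ?_⟩ ?_
  · have hsub : sepSet Φ U W ⊆ sepSet Φ U V \ {φ₀} := by
      intro φ hφW
      rw [sep_iff hU hW hu hwW] at hφW
      obtain ⟨hφ, hlt⟩ := hφW
      have hne : φ p ≠ 0 := by
        intro h
        rw [sgn _ hr2 φ hφ h] at hlt
        nlinarith [mul_self_pos.2 (hu0 φ hφ), hr2.1]
      refine ⟨(sep_iff hU hV hu hv φ).2 ⟨hφ, ?_⟩, ?_⟩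
      · have a := (hr hr2).1 φ hφ hne
        have b : 0 < φ v * φ p := lt_of_le_of_ne (hp.2 φ hφ) (mul_ne_zero (hv0 φ hφ) hne).symm
        set w := φ ((1 - r / 2) • p + (r / 2) • u)
        by_contra! hc
        have h3 : 0 < φ v * φ p * (φ p * w) := mul_pos b a
        have h4 : 0 < (φ v * w) * (φ p * φ p) := by nlinarith
        have h5 : 0 < φ v * w := pos_of_mul_pos_left h4 (mul_self_nonneg _)
        have h6 : 0 ≤ φ u * φ v * (φ v * w) := mul_nonneg hc h5.le
        have h7 : 0 < φ v * φ v := mul_self_pos.2 (hv0 φ hφ)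
        nlinarith
      · rintro rfl
        exact hne hz
    have h1 := Set.ncard_le_ncard hsub ((sepSet_finite Φ U V).subset Set.diff_subset)
    rwa [Set.ncard_diff_singleton_of_mem h₀] at h1
  · apply mem_closure_of_ray (q := u)
    filter_upwards [Ioo_mem_nhdsGT hr0] with s hs
    rw [eW]
    refine ⟨inC s hs, fun φ hφ => ?_⟩
    by_cases h : φ p = 0
    · rw [sgn _ hr2 φ hφ h, sgn _ hs φ hφ h]
      have := mul_pos (mul_pos hr2.1 hs.1) (mul_self_pos.2 (hu0 φ hφ))
      nlinarith
    · have a := (hr hr2).1 φ hφ h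
      have b := (hr hs).1 φ hφ h
      have h4 := mul_pos a b
      have h6 : 0 < (φ ((1 - r / 2) • p + (r / 2) • u) * φ ((1 - s) • p + s • u)) * (φ p * φ p) := by
        nlinarith
      exact pos_of_mul_pos_left h6 (mul_self_nonneg _)

lemma exists_zero {n : ℕ} {C : Set (Rn n)} {Φ : Finset (AffForm n)} {U V : Set (Rn n)}
    (hC : IsPolyhedron C) (hU : IsOpenStratum C Φ U) (hV : IsOpenStratum C Φ V)
    {u y : Rn n} (hu : u ∈ U) (hne : (sepSet Φ U V).Nonempty) (hy : y ∈ closure V)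
    (hb : y ∈ below C Φ U (sdist Φ U V - 1)) : ∃ φ ∈ sepSet Φ U V, φ y = 0 := by
  obtain ⟨v, hv⟩ := hV.1
  simp only [below, Set.mem_iUnion, Set.mem_setOf_eq, exists_prop] at hb
  obtain ⟨W, ⟨hW, hd⟩, hyW⟩ := hb
  obtain ⟨w, hw⟩ := hW.1
  have hpos : 0 < sdist Φ U V := (Set.ncard_pos (sepSet_finite Φ U V)).2 hne
  have hns : ¬ sepSet Φ U V ⊆ sepSet Φ U W := by
    intro h
    have : sdist Φ U V ≤ sdist Φ U W := Set.ncard_le_ncard h (sepSet_finite Φ U W)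
    omega
  obtain ⟨φ, hφV, hφW⟩ := Set.not_subset.1 hns
  refine ⟨φ, hφV, ?_⟩
  rw [sep_iff hU hV hu hv] at hφV
  rw [sep_iff hU hW hu hw] at hφW
  rw [closure_eq hC hV hv] at hy
  rw [closure_eq hC hW hw] at hyW
  obtain ⟨hφ, h1⟩ := hφV
  have hw0 := (stratum_mem hW hw).2.1 φ hφ
  have h2 : 0 ≤ φ u * φ w := not_lt.1 fun h => hφW ⟨hφ, h⟩
  have h3 := hy.2 φ hφ
  have h4 := hyW.2 φ hφ
  rcases mul_neg_iff.1 h1 with ⟨a, b⟩ | ⟨a, b⟩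
  · have c : 0 < φ w := lt_of_le_of_ne (nonneg_of_mul_nonneg_right h2 a) hw0.symm
    exact le_antisymm (by by_contra! hc; nlinarith) (nonneg_of_mul_nonneg_right h4 c)
  · have c : φ w < 0 := lt_of_le_of_ne (by by_contra! hc; nlinarith) hw0
    exact le_antisymm (by by_contra! hc; nlinarith) (nonneg_of_mul_nonneg_right h3 b)

lemma sep_nonempty {n : ℕ} {C : Set (Rn n)} {Φ : Finset (AffForm n)} {U V : Set (Rn n)}
    (hU : IsOpenStratum C Φ U) (hV : IsOpenStratum C Φ V) (hUV : U ≠ V) :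
    (sepSet Φ U V).Nonempty := by
  obtain ⟨u, hu⟩ := hU.1
  obtain ⟨v, hv⟩ := hV.1
  by_contra! h
  apply hUV
  obtain ⟨-, hu0, eU⟩ := stratum_mem hU hu
  obtain ⟨hvC, hv0, eV⟩ := stratum_mem hV hv
  have hvU : v ∈ U := by
    rw [eU]
    refine ⟨hvC, fun φ hφ => ?_⟩
    by_contra! hc
    have : φ ∈ sepSet Φ U V := (sep_iff hU hV hu hv φ).2
      ⟨hφ, lt_of_le_of_ne hc (mul_ne_zero (hu0 φ hφ) (hv0 φ hφ))⟩
    rw [h] at this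
    exact this
  rw [(stratum_mem hU hvU).2.2, eV]

/-- Let `U`, `V` be distinct open strata of `(C, Φ)`, `k := d(U,V) - 1`, and fix `u ∈ U`.
For every `y ∈ closure V` and every `φ ∈ Φ(U,V)` one has `φ u ≠ φ y` and
`t_φ(y) := φ u / (φ u - φ y) ∈ (0,1]`.  Setting `t(y) := max_{φ ∈ Φ(U,V)} t_φ(y)` and
`p(y) := (1 - t(y)) • u + t(y) • y`, the function `t` is continuous on `closure V`, the
segment `[p(y), y]` is contained in `closure V`, `p(y) ∈ closure V ∩ U_{≤ k}`, and
`p(y) = y` iff `y ∈ closure V ∩ U_{≤ k}`.  In particular `p` is a continuous retraction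
of `closure V` onto `closure V ∩ U_{≤ k}`. -/
theorem retraction_onto_below {n : ℕ} (C : Set (Rn n)) (Φ : Finset (AffForm n))
    (hC : IsPolyhedron C) (hΦ : ∀ φ ∈ Φ, φ.linear ≠ 0)
    (U V : Set (Rn n)) (hU : IsOpenStratum C Φ U) (hV : IsOpenStratum C Φ V)
    (hUV : U ≠ V) (u : Rn n) (hu : u ∈ U) :
    (∀ y ∈ closure V, ∀ φ ∈ sepSet Φ U V,
      φ u ≠ φ y ∧ φ u / (φ u - φ y) ∈ Set.Ioc (0:ℝ) 1) ∧
    ∃ t : Rn n → ℝ,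
      (∀ y ∈ closure V,
        IsGreatest ((fun φ : AffForm n => φ u / (φ u - φ y)) '' sepSet Φ U V) (t y)) ∧
      ContinuousOn t (closure V) ∧
      ContinuousOn (fun y => (1 - t y) • u + t y • y) (closure V) ∧
      (∀ y ∈ closure V, segment ℝ ((1 - t y) • u + t y • y) y ⊆ closure V) ∧
      (∀ y ∈ closure V,
        (1 - t y) • u + t y • y ∈ closure V ∩ below C Φ U (sdist Φ U V - 1)) ∧
      (∀ y ∈ closure V,
        ((1 - t y) • u + t y • y = y ↔ y ∈ closure V ∩ below C Φ U (sdist Φ U V - 1))) := by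
  obtain ⟨v, hv⟩ := hV.1
  obtain ⟨huC, hu0, eU⟩ := stratum_mem hU hu
  obtain ⟨hvC, hv0, eV⟩ := stratum_mem hV hv
  have hne := sep_nonempty hU hV hUV
  have hcl := closure_eq hC hV hv
  -- signs of a separating form
  have hs : ∀ y ∈ closure V, ∀ φ ∈ sepSet Φ U V,
      (0 < φ u ∧ φ y ≤ 0) ∨ (φ u < 0 ∧ 0 ≤ φ y) := by
    intro y hy φ hφ
    rw [sep_iff hU hV hu hv] at hφ
    rw [hcl] at hy
    have h3 := hy.2 φ hφ.1
    rcases mul_neg_iff.1 hφ.2 with ⟨a, b⟩ | ⟨a, b⟩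
    · exact Or.inl ⟨a, by by_contra! hc; nlinarith⟩
    · exact Or.inr ⟨a, by by_contra! hc; nlinarith⟩
  have h1 : ∀ y ∈ closure V, ∀ φ ∈ sepSet Φ U V,
      φ u ≠ φ y ∧ φ u / (φ u - φ y) ∈ Set.Ioc (0:ℝ) 1 := by
    intro y hy φ hφ
    rcases hs y hy φ hφ with ⟨a, b⟩ | ⟨a, b⟩
    · have : 0 < φ u - φ y := by linarith
      exact ⟨by linarith, div_pos a this, (div_le_one this).2 (by linarith)⟩
    · have : φ u - φ y < 0 := by linarith
      exact ⟨by linarith, div_pos_of_neg_of_neg a this,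
        (div_le_one_of_neg this).2 (by linarith)⟩
  refine ⟨h1, ?_⟩
  have hfin := sepSet_finite Φ U V
  have hneF : hfin.toFinset.Nonempty := by simpa using hne
  let t : Rn n → ℝ := fun y => hfin.toFinset.sup' hneF fun φ => φ u / (φ u - φ y)
  have htG : ∀ y, IsGreatest ((fun φ : AffForm n => φ u / (φ u - φ y)) '' sepSet Φ U V) (t y) := by
    intro y
    constructor
    · obtain ⟨φ, hφ, e⟩ := Finset.exists_mem_eq_sup' hneF fun φ : AffForm n => φ u / (φ u - φ y)
      exact ⟨φ, by simpa using hφ, e.symm⟩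
    · rintro _ ⟨φ, hφ, rfl⟩
      exact Finset.le_sup' (fun φ : AffForm n => φ u / (φ u - φ y)) (by simpa using hφ)
  have htc : ContinuousOn t (closure V) := by
    refine ContinuousOn.finset_sup'_apply hneF fun φ hφ => ?_
    refine continuousOn_const.div (continuousOn_const.sub (aff_cont φ).continuousOn) ?_
    intro y hy
    exact sub_ne_zero.2 (h1 y hy φ (by simpa using hφ)).1
  have ht01 : ∀ y ∈ closure V, 0 < t y ∧ t y ≤ 1 := by
    intro y hy
    obtain ⟨φ, hφ, e⟩ := (htG y).1
    rw [← e]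
    exact (h1 y hy φ hφ).2
  have hpcl : ∀ y ∈ closure V, (1 - t y) • u + t y • y ∈ closure V := by
    intro y hy
    have hy' := hy
    rw [hcl] at hy' ⊢
    obtain ⟨t0, t1⟩ := ht01 y hy
    refine ⟨poly_combo hC huC hy'.1 t0.le t1, fun φ hφ => ?_⟩
    rw [aff_combo]
    have h3 := hy'.2 φ hφ
    by_cases hsep : φ ∈ sepSet Φ U V
    · have hle : φ u / (φ u - φ y) ≤ t y := (htG y).2 ⟨φ, hsep, rfl⟩
      have hlt := ((sep_iff hU hV hu hv φ).1 hsep).2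
      rcases hs y hy φ hsep with ⟨a, b⟩ | ⟨a, b⟩
      · rw [div_le_iff₀ (by linarith)] at hle
        exact mul_nonneg_of_nonpos_of_nonpos (by by_contra! hc; nlinarith) (by linarith)
      · rw [div_le_iff_of_neg (by linarith)] at hle
        exact mul_nonneg (by by_contra! hc; nlinarith) (by linarith)
    · have h4 : 0 ≤ φ u * φ v := not_lt.1 fun h => hsep ((sep_iff hU hV hu hv φ).2 ⟨hφ, h⟩)
      have h5 := mul_nonneg (sub_nonneg.2 t1) h4
      have h6 := mul_nonneg t0.le h3
      nlinarith
  have hconv : Convex ℝ (closure V) := by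
    rw [convex_iff_forall_pos]
    intro x hx y hy a b ha hb hab
    rw [hcl] at hx hy ⊢
    obtain rfl : a = 1 - b := by linarith
    refine ⟨poly_combo hC hx.1 hy.1 hb.le (by linarith), fun φ hφ => ?_⟩
    rw [aff_combo]
    have h5 := mul_nonneg ha.le (hx.2 φ hφ)
    have h6 := mul_nonneg hb.le (hy.2 φ hφ)
    nlinarith
  have hpb : ∀ y ∈ closure V,
      (1 - t y) • u + t y • y ∈ closure V ∩ below C Φ U (sdist Φ U V - 1) := by
    intro y hy
    obtain ⟨φ, hφ, e⟩ := (htG y).1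
    refine ⟨hpcl y hy, mem_below hC hU hV hu (hpcl y hy) hφ ?_⟩
    rw [aff_combo, ← e]
    have := sub_ne_zero.2 (h1 y hy φ hφ).1
    field_simp
    ring
  refine ⟨t, fun y _ => htG y, htc, ?_, ?_, hpb, ?_⟩
  · exact ((continuousOn_const.sub htc).smul continuousOn_const).add (htc.smul continuousOn_id)
  · exact fun y hy => hconv.segment_subset (hpcl y hy) hy
  · intro y hy
    constructor
    · intro h
      rw [← h]
      exact hpb y hy
    · rintro ⟨-, hb⟩
      obtain ⟨φ, hφ, hz⟩ := exists_zero hC hU hV hu hne hy hb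
      have hle : φ u / (φ u - φ y) ≤ t y := (htG y).2 ⟨φ, hφ, rfl⟩
      rw [hz, sub_zero, div_self (hu0 φ hφ.1)] at hle
      have : t y = 1 := le_antisymm (ht01 y hy).2 hle
      rw [this]
      simp
end
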